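/- Let H be a real Hilbert space, F ⊂ H compact, and (f_n)_{n≥1} a greedy sequence for F with associated quantities σ_n and Kolmogorov widths d_n. For every α > 0 there exists a constant C > 0, depending only on α, such that: if d_0 > 0 and d_I ≤ d_0 · I^{−α} for all I ≥ 1, then σ_I ≤ C · d_0 · I^{−α} for all I ≥ 1. -/

import Mathlib

open Metric Set

/-- `σ_n := sup_{x ∈ F} dist(x, span{f 1, …, f n})`. -/
noncomputable def greedySigma {H : Type*} [NormedAddCommGroup H] [InnerProductSpace ℝ H]
    (F : Set H) (f : ℕ → H) (n : ℕ) : ℝ :=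
  ⨆ x ∈ F, Metric.infDist x (Submodule.span ℝ (f '' Set.Icc 1 n) : Set H)

/-- A greedy sequence for `F`: `f (n+1) ∈ F` maximizes the distance to the span of the
previously selected elements over `F`. -/
def IsGreedy {H : Type*} [NormedAddCommGroup H] [InnerProductSpace ℝ H]
    (F : Set H) (f : ℕ → H) : Prop :=
  ∀ n : ℕ, f (n + 1) ∈ F ∧ ∀ x ∈ F,
    Metric.infDist x (Submodule.span ℝ (f '' Set.Icc 1 n) : Set H) ≤
      Metric.infDist (f (n + 1)) (Submodule.span ℝ (f '' Set.Icc 1 n) : Set H)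

/-- Kolmogorov `I`-width of `F`: the infimum over all subspaces `V` of dimension at most `I`
of `sup_{x ∈ F} dist(x, V)`. -/
noncomputable def kolWidth {H : Type*} [NormedAddCommGroup H] [InnerProductSpace ℝ H]
    (F : Set H) (I : ℕ) : ℝ :=
  ⨅ V : {V : Submodule ℝ H // FiniteDimensional ℝ V ∧ Module.finrank ℝ V ≤ I},
    ⨆ x ∈ F, Metric.infDist x ((V : Submodule ℝ H) : Set H)

/-- If the average of the nonnegative numbers `z i` is at most `c`, their product is at most
`c ^ card ι`. -/
theorem prod_le_pow_card_of_sum_le {ι : Type*} [Fintype ι] {z : ι → ℝ} {c : ℝ} (hc : 0 < c)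
    (hz : ∀ i, 0 ≤ z i) (h : ∑ i, z i ≤ c * Fintype.card ι) :
    ∏ i, z i ≤ c ^ Fintype.card ι := by
  have h1 : ∏ i, z i / c ≤ 1 := by
    calc ∏ i, z i / c ≤ ∏ i, Real.exp (z i / c - 1) :=
          Finset.prod_le_prod (fun i _ => div_nonneg (hz i) hc.le)
            (fun i _ => by linarith [Real.add_one_le_exp (z i / c - 1)])
      _ = Real.exp ((∑ i, z i) / c - Fintype.card ι) := by
          rw [← Real.exp_sum, Finset.sum_sub_distrib, Finset.sum_div]
          simp
      _ ≤ 1 := by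
          rw [Real.exp_le_one_iff, sub_nonpos, div_le_iff₀ hc]
          linarith
  rw [Finset.prod_div_distrib, Finset.prod_const, Finset.card_univ, div_le_one (by positivity)] at h1
  exact h1

/-- A Hadamard-type inequality, in terms of the Frobenius norm. -/
theorem Matrix.det_sq_le_pow_of_sum_sq_le {ι : Type*} [Fintype ι] [DecidableEq ι]
    (M : Matrix ι ι ℝ) {c : ℝ} (hc : 0 < c) (h : ∑ i, ∑ j, M i j ^ 2 ≤ c * Fintype.card ι) :
    M.det ^ 2 ≤ c ^ Fintype.card ι := by
  have hA : (M * M.conjTranspose).PosSemidef := Matrix.posSemidef_self_mul_conjTranspose M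
  have hdet : (M * M.conjTranspose).det = M.det ^ 2 := by
    rw [Matrix.det_mul, Matrix.conjTranspose_eq_transpose_of_trivial, Matrix.det_transpose, sq]
  have htr : (M * M.conjTranspose).trace = ∑ i, ∑ j, M i j ^ 2 := by
    simp [Matrix.trace, Matrix.mul_apply, sq]
  rw [← hdet, hA.1.det_eq_prod_eigenvalues]
  rw [← htr, hA.1.trace_eq_sum_eigenvalues] at h
  exact prod_le_pow_card_of_sum_le hc hA.eigenvalues_nonneg h

/-- A subspace of dimension at most `m` in a space of dimension `m + n` admits an orthonormal basis
whose last `n` vectors are orthogonal to it. -/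
theorem Submodule.exists_orthonormalBasis_natAdd_mem_orthogonal {E : Type*} [NormedAddCommGroup E]
    [InnerProductSpace ℝ E] [FiniteDimensional ℝ E] {m n : ℕ} (hE : Module.finrank ℝ E = m + n)
    (W : Submodule ℝ E) (hW : Module.finrank ℝ W ≤ m) :
    ∃ b : OrthonormalBasis (Fin (m + n)) ℝ E, ∀ j : Fin n, b (Fin.natAdd m j) ∈ Wᗮ := by
  have hn : n ≤ Module.finrank ℝ Wᗮ := by
    have := W.finrank_add_finrank_orthogonal
    omega
  let v : Fin m ⊕ Fin n → E :=
    Sum.elim 0 fun j => (stdOrthonormalBasis ℝ Wᗮ (Fin.castLE hn j) : E)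
  have hv : Orthonormal ℝ ((Set.range Sum.inr).domRestrict v) := by
    have h0 : Orthonormal ℝ fun j : Fin n => (stdOrthonormalBasis ℝ Wᗮ (Fin.castLE hn j) : E) :=
      ((stdOrthonormalBasis ℝ Wᗮ).orthonormal.comp_linearIsometry Wᗮ.subtypeₗᵢ).comp _
        (Fin.castLE_injective hn)
    constructor
    · rintro ⟨_, j, rfl⟩
      exact h0.1 j
    · rintro ⟨_, j, rfl⟩ ⟨_, k, rfl⟩ hjk
      exact h0.2 fun h => hjk (by simp [h])
  obtain ⟨b, hb⟩ := hv.exists_orthonormalBasis_extension_of_card_eq (by simp [hE])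
  refine ⟨b.reindex finSumFinEquiv, fun j => ?_⟩
  have : finSumFinEquiv.symm (Fin.natAdd m j) = Sum.inr j := by simp
  rw [OrthonormalBasis.reindex_apply, this, hb _ ⟨j, rfl⟩]
  exact (stdOrthonormalBasis ℝ Wᗮ (Fin.castLE hn j)).2

/-- The volume of a family of `2 m` vectors of length at most `s` which lie within distance `d`
of a subspace of dimension at most `m`. -/
theorem OrthonormalBasis.det_sq_le_of_norm_sub_le {E : Type*} [NormedAddCommGroup E]
    [InnerProductSpace ℝ E] {m : ℕ} (e : OrthonormalBasis (Fin (m + m)) ℝ E)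
    (W : Submodule ℝ E) (hW : Module.finrank ℝ W ≤ m) {s d : ℝ} (hs : 0 < s) (hd : 0 < d)
    (r : Fin (m + m) → E) (hr : ∀ i, ‖r i‖ ≤ s) (hrW : ∀ i, ∃ w ∈ W, ‖r i - w‖ ≤ d) :
    (Matrix.of fun i j => inner ℝ (e j) (r i)).det ^ 2 ≤ (2 * s * d) ^ (m + m) := by
  have : FiniteDimensional ℝ E := e.toBasis.finiteDimensional_of_finite
  have hE : Module.finrank ℝ E = m + m := by
    rw [Module.finrank_eq_card_basis e.toBasis, Fintype.card_fin]
  obtain ⟨b, hb⟩ := W.exists_orthonormalBasis_natAdd_mem_orthogonal hE hW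
  have hgram (b' : OrthonormalBasis (Fin (m + m)) ℝ E) :
      (Matrix.of fun i j => inner ℝ (b' j) (r i)).det ^ 2 =
        (Matrix.of fun i k => inner ℝ (r i) (r k)).det := by
    rw [sq]
    nth_rw 2 [← Matrix.det_transpose]
    rw [← Matrix.det_mul]
    congr 1
    ext i k
    simp only [Matrix.mul_apply, Matrix.of_apply, Matrix.transpose_apply]
    rw [← b'.sum_inner_mul_inner]
    exact Finset.sum_congr rfl fun j _ => by rw [real_inner_comm]
  rw [hgram e, ← hgram b]
  let D : Fin (m + m) → ℝ := Fin.append (fun _ => s⁻¹) (fun _ => d⁻¹)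
  have hD : ∏ j, D j = ((s * d) ^ m)⁻¹ := by
    simp only [D, Fin.prod_univ_add, Fin.append_left, Fin.append_right, Finset.prod_const,
      Finset.card_univ, Fintype.card_fin, inv_pow, mul_pow, mul_inv]
  have hrow (i : Fin (m + m)) : ∑ j, (inner ℝ (b j) (r i) * D j) ^ 2 ≤ 2 := by
    have h1 : ∑ j : Fin m, inner ℝ (b (Fin.castAdd m j)) (r i) ^ 2 ≤ s ^ 2 := by
      have := (b.orthonormal.comp _ (Fin.castAdd_injective m m)).sum_inner_products_le (r i)
        (s := Finset.univ)
      simp only [Real.norm_eq_abs, sq_abs, Function.comp_apply] at this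
      exact this.trans (pow_le_pow_left₀ (norm_nonneg _) (hr i) 2)
    have h2 : ∑ j : Fin m, inner ℝ (b (Fin.natAdd m j)) (r i) ^ 2 ≤ d ^ 2 := by
      obtain ⟨w, hw, hwd⟩ := hrW i
      have := (b.orthonormal.comp _ (Fin.natAdd_injective m m)).sum_inner_products_le (r i - w)
        (s := Finset.univ)
      simp only [Real.norm_eq_abs, sq_abs, Function.comp_apply, inner_sub_right,
        Submodule.inner_left_of_mem_orthogonal hw (hb _), sub_zero] at this
      exact this.trans (pow_le_pow_left₀ (norm_nonneg _) hwd 2)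
    simp only [Fin.sum_univ_add, D, Fin.append_left, Fin.append_right, mul_pow,
      inv_pow, ← div_eq_mul_inv, ← Finset.sum_div]
    have h3 := (div_le_one (pow_pos hs 2)).2 h1
    have h4 := (div_le_one (pow_pos hd 2)).2 h2
    linarith
  have hdet := Matrix.det_sq_le_pow_of_sum_sq_le
    ((Matrix.of fun i j => inner ℝ (b j) (r i)) * Matrix.diagonal D) two_pos (by
      simp only [Matrix.mul_diagonal, Matrix.of_apply]
      refine (Finset.sum_le_sum fun i _ => hrow i).trans ?_
      simp [mul_comm])
  rw [Matrix.det_mul, Matrix.det_diagonal, hD, Fintype.card_fin, mul_pow, inv_pow, ← pow_mul,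
    ← div_eq_mul_inv, div_le_iff₀ (by positivity)] at hdet
  refine hdet.trans_eq ?_
  rw [mul_assoc 2 s d, mul_pow 2 (s * d), mul_two m]

section

open InnerProductSpace

variable {H : Type*} [NormedAddCommGroup H] [InnerProductSpace ℝ H]

theorem infDist_span_Iio_le_norm_gramSchmidt (g : ℕ → H) (n : ℕ) :
    infDist (g n) (Submodule.span ℝ (g '' Set.Iio n) : Set H) ≤ ‖gramSchmidt ℝ g n‖ := by
  have h : g n - gramSchmidt ℝ g n ∈ Submodule.span ℝ (g '' Set.Iio n) := by
    rw [← span_gramSchmidt_Iio ℝ g n]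
    nth_rw 1 [gramSchmidt_def'' ℝ g n]
    rw [add_sub_cancel_left]
    exact Submodule.sum_mem _ fun i hi => Submodule.smul_mem _ _
      (Submodule.subset_span ⟨i, Finset.mem_Iio.1 hi, rfl⟩)
  refine (infDist_le_dist_of_mem h).trans_eq ?_
  rw [dist_eq_norm, sub_sub_cancel]

theorem inner_gramSchmidt_self (g : ℕ → H) (n : ℕ) :
    inner ℝ (gramSchmidt ℝ g n) (g n) = ‖gramSchmidt ℝ g n‖ ^ 2 := by
  rw [gramSchmidt_def'' ℝ g n, inner_add_right, inner_sum, real_inner_self_eq_norm_sq, Finset.sum_eq_zero, add_zero]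
  intro i hi
  rw [inner_smul_right, gramSchmidt_orthogonal ℝ g (Finset.mem_Iio.1 hi).ne', mul_zero]

/-- If `2 m` consecutive members of a sequence are within distance `s` of the span of the earlier
ones and within distance `d` of a subspace of dimension at most `m`, then the product of their
distances to the spans of their predecessors is at most `(2 * s * d) ^ m`. -/
theorem prod_infDist_span_Iio_le (g : ℕ → H) (N m : ℕ)
    (V : Submodule ℝ H) [FiniteDimensional ℝ V] (hV : Module.finrank ℝ V ≤ m) {s d : ℝ}
    (hs : 0 < s) (hd : 0 < d)
    (hgs : ∀ i < m + m, infDist (g (N + i)) (Submodule.span ℝ (g '' Set.Iio N) : Set H) ≤ s)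
    (hgV : ∀ i < m + m, ∃ v ∈ V, ‖g (N + i) - v‖ ≤ d) :
    ∏ i : Fin (m + m), infDist (g (N + i)) (Submodule.span ℝ (g '' Set.Iio (N + i)) : Set H) ≤
      (2 * s * d) ^ m := by
  have hle : ∏ i : Fin (m + m),
      infDist (g (N + i)) (Submodule.span ℝ (g '' Set.Iio (N + i)) : Set H) ≤
        ∏ i : Fin (m + m), ‖gramSchmidt ℝ g (N + i)‖ :=
    Finset.prod_le_prod (fun _ _ => infDist_nonneg)
      fun i _ => infDist_span_Iio_le_norm_gramSchmidt g _
  refine hle.trans ?_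
  by_cases h0 : ∃ i : Fin (m + m), gramSchmidt ℝ g (N + i) = 0
  · obtain ⟨i, hi⟩ := h0
    rw [Finset.prod_eq_zero (Finset.mem_univ i) (by rw [hi, norm_zero])]
    positivity
  push Not at h0
  let e : Fin (m + m) → H := fun i => gramSchmidtNormed ℝ g (N + i)
  have he : Orthonormal ℝ e := by
    refine (gramSchmidtNormed_orthonormal' (𝕜 := ℝ) g).comp
      (fun i : Fin (m + m) => ⟨N + i, ?_⟩) fun i j hij => ?_
    · simpa [gramSchmidtNormed] using h0 i
    · simpa [Fin.ext_iff] using hij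
  let T : H →ₗ[ℝ] EuclideanSpace ℝ (Fin (m + m)) :=
    (WithLp.linearEquiv 2 ℝ (Fin (m + m) → ℝ)).symm.toLinearMap ∘ₗ
      LinearMap.pi fun j => innerₛₗ ℝ (e j)
  have hT (x : H) (j : Fin (m + m)) : T x j = inner ℝ (e j) x := rfl
  have hTle (x : H) : ‖T x‖ ≤ ‖x‖ := by
    rw [← sq_le_sq₀ (norm_nonneg _) (norm_nonneg _), EuclideanSpace.norm_sq_eq]
    exact he.sum_inner_products_le x
  have hTker : ∀ y ∈ Submodule.span ℝ (g '' Set.Iio N), T y = 0 := by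
    intro y hy
    refine (Submodule.span_le (p := LinearMap.ker T)).2 ?_ hy
    rintro _ ⟨i, hi, rfl⟩
    ext j
    rw [hT]
    simp only [e, gramSchmidtNormed, real_inner_smul_left]
    rw [gramSchmidt_inv_triangular ℝ g ((Set.mem_Iio.1 hi).trans_le (Nat.le_add_right N j)),
      mul_zero]
    rfl
  have hdet := (EuclideanSpace.basisFun (Fin (m + m)) ℝ).det_sq_le_of_norm_sub_le (V.map T)
    ((Submodule.finrank_map_le T V).trans hV) hs hd (fun i => T (g (N + i)))
    (fun i => by
      refine le_trans ((le_infDist ⟨0, Submodule.zero_mem _⟩).2 fun y hy => ?_) (hgs i i.2)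
      rw [dist_eq_norm]
      simpa [hTker y hy] using hTle (g (N + i) - y))
    (fun i => by
      obtain ⟨v, hv, hvd⟩ := hgV i i.2
      refine ⟨T v, Submodule.mem_map_of_mem hv, ?_⟩
      rw [← map_sub]
      exact (hTle _).trans hvd)
  rw [Matrix.det_of_isLowerTriangular] at hdet
  · have heq (i : Fin (m + m)) : inner ℝ (e i) (g (N + i)) = ‖gramSchmidt ℝ g (N + i)‖ := by
      have := norm_ne_zero_iff.2 (h0 i)
      simp only [e, gramSchmidtNormed, real_inner_smul_left, inner_gramSchmidt_self]
      simp
      field_simp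
    simp only [Matrix.of_apply, EuclideanSpace.basisFun_inner, hT, heq] at hdet
    have hexp : (2 * s * d) ^ (m + m) = ((2 * s * d) ^ m) ^ 2 := by rw [← pow_mul, mul_two]
    rw [hexp] at hdet
    exact (pow_le_pow_iff_left₀ (by positivity) (by positivity) two_ne_zero).1 hdet
  · intro i j hij
    simp only [Matrix.of_apply, EuclideanSpace.basisFun_inner, hT, e, gramSchmidtNormed,
      real_inner_smul_left]
    rw [gramSchmidt_inv_triangular ℝ g (Nat.add_lt_add_left (show (i : ℕ) < j from hij) N),
      mul_zero]

end

section

variable {H : Type*} [NormedAddCommGroup H] [InnerProductSpace ℝ H]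

theorem infDist_submodule_le_norm (V : Submodule ℝ H) (x : H) : infDist x (V : Set H) ≤ ‖x‖ := by
  simpa using infDist_le_dist_of_mem (x := x) V.zero_mem

theorem exists_submodule_of_kolWidth_lt {F : Set H} (hF : Bornology.IsBounded F) {m : ℕ} {c : ℝ}
    (h : kolWidth F m < c) :
    ∃ V : Submodule ℝ H, FiniteDimensional ℝ V ∧ Module.finrank ℝ V ≤ m ∧
      ∀ x ∈ F, ∃ v ∈ V, ‖x - v‖ ≤ c := by
  have : Nonempty {V : Submodule ℝ H // FiniteDimensional ℝ V ∧ Module.finrank ℝ V ≤ m} :=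
    ⟨⊥, inferInstance, by simp⟩
  obtain ⟨⟨V, hfd, hV⟩, hc⟩ := exists_lt_of_ciInf_lt h
  refine ⟨V, hfd, hV, fun x hx => ?_⟩
  obtain ⟨B, hB⟩ := hF.exists_norm_le
  have hbdd : BddAbove (Set.range fun x => ⨆ _ : x ∈ F, infDist x (V : Set H)) := by
    refine ⟨max B 0, ?_⟩
    rintro _ ⟨y, rfl⟩
    exact Real.iSup_le (fun hy => (infDist_submodule_le_norm V y).trans
      ((hB y hy).trans (le_max_left _ _))) (le_max_right _ _)
  have hle := le_ciSup hbdd x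
  simp only [hx, ciSup_unique] at hle
  obtain ⟨v, hv, hxv⟩ := (infDist_lt_iff ⟨0, V.zero_mem⟩).1 (hle.trans_lt hc)
  exact ⟨v, hv, by rw [← dist_eq_norm]; exact hxv.le⟩

/-- The distance from `f (n + 1)` to the span of `f 1, …, f n`. -/
noncomputable def greedyDist (f : ℕ → H) (n : ℕ) : ℝ :=
  infDist (f (n + 1)) (Submodule.span ℝ (f '' Set.Icc 1 n) : Set H)

theorem greedyDist_nonneg (f : ℕ → H) (n : ℕ) : 0 ≤ greedyDist f n := infDist_nonneg

theorem image_Icc_one_eq_image_Iio {β : Type*} (f : ℕ → β) (n : ℕ) :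
    f '' Set.Icc 1 n = (fun i => f (i + 1)) '' Set.Iio n := by
  have : Set.Icc 1 n = (fun i => i + 1) '' Set.Iio n := by
    ext i
    simp only [Set.mem_Icc, Set.mem_image, Set.mem_Iio]
    exact ⟨fun h => ⟨i - 1, by omega, by omega⟩, by rintro ⟨j, hj, rfl⟩; omega⟩
  rw [this, Set.image_image]

namespace IsGreedy

variable {F : Set H} {f : ℕ → H}

theorem greedySigma_le_greedyDist (hf : IsGreedy F f) (n : ℕ) :
    greedySigma F f n ≤ greedyDist f n :=
  Real.iSup_le (fun x => Real.iSup_le (fun hx => (hf n).2 x hx) infDist_nonneg) infDist_nonneg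

theorem antitone_greedyDist (hf : IsGreedy F f) : Antitone (greedyDist f) := by
  refine antitone_nat_of_succ_le fun n => ?_
  refine le_trans ?_ ((hf n).2 _ (hf (n + 1)).1)
  exact infDist_le_infDist_of_subset
    (Submodule.span_mono (Set.image_mono (Set.Icc_subset_Icc_right n.le_succ)))
    ⟨0, Submodule.zero_mem _⟩

theorem prod_greedyDist_le (hf : IsGreedy F f) (hF : Bornology.IsBounded F) {m : ℕ} {c : ℝ}
    (hc : 0 < c) (hm : kolWidth F m < c) {N : ℕ} (hN : 0 < greedyDist f N) :
    ∏ i : Fin (m + m), greedyDist f (N + i) ≤ (2 * greedyDist f N * c) ^ m := by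
  obtain ⟨V, hfd, hV, hVF⟩ := exists_submodule_of_kolWidth_lt hF hm
  have h := prod_infDist_span_Iio_le (fun i => f (i + 1)) N m V hV hN hc (fun i _ => ?_)
    fun i _ => hVF _ (hf _).1
  · simpa only [greedyDist, image_Icc_one_eq_image_Iio] using h
  · rw [← image_Icc_one_eq_image_Iio]
    exact (hf N).2 _ (hf (N + i)).1

theorem sq_greedyDist_le (hf : IsGreedy F f) (hF : Bornology.IsBounded F) {m : ℕ} (hm0 : m ≠ 0)
    {c : ℝ} (hc : 0 < c) (hm : kolWidth F m < c) (N : ℕ) :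
    greedyDist f (N + 2 * m) ^ 2 ≤ 2 * greedyDist f N * c := by
  have hnn := greedyDist_nonneg f
  rcases (hnn N).eq_or_lt with h0 | h0
  · have h1 := hf.antitone_greedyDist (Nat.le_add_right N (2 * m))
    have h2 : greedyDist f (N + 2 * m) = 0 := le_antisymm (h1.trans_eq h0.symm) (hnn _)
    rw [h2, ← h0]
    simp
  · have h1 : ∏ _i : Fin (m + m), greedyDist f (N + 2 * m) ≤
        ∏ i : Fin (m + m), greedyDist f (N + i) :=
      Finset.prod_le_prod (fun _ _ => hnn _) fun i _ => hf.antitone_greedyDist (by omega)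
    have h2 := h1.trans (hf.prod_greedyDist_le hF hc hm h0)
    rw [Finset.prod_const, Finset.card_univ, Fintype.card_fin, ← two_mul, pow_mul] at h2
    exact (pow_le_pow_iff_left₀ (by positivity) (by positivity) hm0).1 h2

theorem greedyDist_one_le (hf : IsGreedy F f) (hF : Bornology.IsBounded F) {c : ℝ} (hc : 0 < c)
    (h : kolWidth F 1 < c) : greedyDist f 1 ≤ 2 * c := by
  rcases (greedyDist_nonneg f 0).eq_or_lt with h0 | h0
  · have := hf.antitone_greedyDist zero_le_one
    linarith
  · have h1 := hf.prod_greedyDist_le hF hc h h0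
    simp only [Nat.reduceAdd, Fin.prod_univ_two, zero_add, pow_one, Fin.val_zero, Fin.val_one] at h1
    refine le_of_mul_le_mul_left (h1.trans_eq ?_) h0
    ring

/-- Algebraic decay along powers of two, with `q = 2 ^ (-α)`. -/
theorem greedyDist_two_pow_le (hf : IsGreedy F f) (hF : Bornology.IsBounded F) {d₀ q : ℝ}
    (hd₀ : 0 < d₀) (hq : 0 < q) (hq1 : q ≤ 1) (h : ∀ k : ℕ, kolWidth F (2 ^ k) ≤ d₀ * q ^ k)
    (k : ℕ) : greedyDist f (2 ^ k) ≤ 4 / q ^ 3 * d₀ * q ^ k := by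
  have hlt (k : ℕ) : kolWidth F (2 ^ k) < 2 * (d₀ * q ^ k) := by
    have : 0 < d₀ * q ^ k := by positivity
    linarith [h k]
  have h1 : greedyDist f 1 ≤ 4 * d₀ := by
    have := hf.greedyDist_one_le (c := 2 * d₀) hF (by positivity) (by simpa using hlt 0)
    linarith
  have hbase (k : ℕ) (hk : k ≤ 3) : 4 * d₀ ≤ 4 / q ^ 3 * d₀ * q ^ k := by
    have : q ^ 3 ≤ q ^ k := pow_le_pow_of_le_one hq.le hq1 hk
    rw [div_mul_eq_mul_div, div_mul_eq_mul_div, le_div_iff₀ (by positivity)]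
    gcongr
  induction k with
  | zero => exact h1.trans (hbase 0 (by norm_num))
  | succ k ih =>
    rcases k with _ | k
    · exact (hf.antitone_greedyDist (by norm_num)).trans (h1.trans (hbase 1 (by norm_num)))
    · have hstep := hf.sq_greedyDist_le hF (pow_ne_zero k two_ne_zero) (by positivity) (hlt k)
        (2 ^ (k + 1))
      have hidx : 2 ^ (k + 1) + 2 * 2 ^ k = 2 ^ (k + 1 + 1) := by ring
      rw [hidx] at hstep
      refine (pow_le_pow_iff_left₀ (greedyDist_nonneg f _) (by positivity) two_ne_zero).1 ?_
      calc greedyDist f (2 ^ (k + 1 + 1)) ^ 2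
          ≤ 2 * (4 / q ^ 3 * d₀ * q ^ (k + 1)) * (2 * (d₀ * q ^ k)) := hstep.trans (by gcongr)
        _ = (4 / q ^ 3 * d₀ * q ^ (k + 1 + 1)) ^ 2 := by
          field_simp
          ring

end IsGreedy

end

/-- If the Kolmogorov widths decay algebraically, `d_I ≤ d₀ I^{−α}`, then so do the greedy
quantities: `σ_I ≤ C d₀ I^{−α}`, with a constant `C` depending only on `α`. -/
theorem greedy_algebraic_decay :
    ∀ α : ℝ, 0 < α → ∃ C : ℝ, 0 < C ∧
      ∀ (H : Type*) [NormedAddCommGroup H] [InnerProductSpace ℝ H],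
        ∀ F : Set H, IsCompact F → ∀ f : ℕ → H, IsGreedy F f →
          ∀ d₀ : ℝ, 0 < d₀ →
            (∀ I : ℕ, 1 ≤ I → kolWidth F I ≤ d₀ * (I : ℝ) ^ (-α)) →
            ∀ I : ℕ, 1 ≤ I → greedySigma F f I ≤ C * d₀ * (I : ℝ) ^ (-α) := by
  intro α hα
  set q : ℝ := 2 ^ (-α) with hq_def
  have hq : 0 < q := by positivity
  have hq1 : q ≤ 1 := Real.rpow_le_one_of_one_le_of_nonpos one_le_two (by linarith)
  have hpow (k : ℕ) : ((2 ^ k : ℕ) : ℝ) ^ (-α) = q ^ k := by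
    rw [hq_def, Nat.cast_pow, Nat.cast_ofNat, Real.rpow_pow_comm two_pos.le]
  refine ⟨4 / q ^ 4, by positivity, fun H _ _ F hF f hf d₀ hd₀ hwidth I hI => ?_⟩
  have hk : 2 ^ Nat.log 2 I ≤ I := Nat.pow_log_le_self 2 (by omega)
  have hk' : I < 2 ^ (Nat.log 2 I + 1) := Nat.lt_pow_succ_log_self one_lt_two I
  calc greedySigma F f I ≤ greedyDist f I := hf.greedySigma_le_greedyDist I
    _ ≤ greedyDist f (2 ^ Nat.log 2 I) := hf.antitone_greedyDist hk
    _ ≤ 4 / q ^ 3 * d₀ * q ^ Nat.log 2 I :=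
        hf.greedyDist_two_pow_le hF.isBounded hd₀ hq hq1
          (fun k => by rw [← hpow]; exact hwidth _ Nat.one_le_two_pow) _
    _ = 4 / q ^ 4 * d₀ * q ^ (Nat.log 2 I + 1) := by
        field_simp
        ring
    _ ≤ 4 / q ^ 4 * d₀ * (I : ℝ) ^ (-α) := by
        gcongr
        rw [← hpow]
        exact Real.rpow_le_rpow_of_nonpos (by exact_mod_cast hI) (by exact_mod_cast hk'.le)
          (by linarith)
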